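/- arXiv:2007.13309 — 4 statements merged into one kernel-verified Lean document; each statement's English description precedes it below -/
import Mathlib

section
/- Let q = p^e be a prime power (p prime), m ≥ 2 an even integer, and n = (q^{2m}−1)/(q+1). For every integer δ with 2 ≤ δ ≤ δ^max, there exists an F_{q²}-linear subspace C ⊆ (F_{q²})^n such that: (i) the F_{q²}-dimension of C equals n − 𝒩(q,m,δ); (ii) C is Hermitian dual-containing, i.e. C^{⊥H} ⊆ C; and (iii) every nonzero vector of C has Hamming weight at least δ. -/
/-- The maximum design distance `δ^max`. -/
def deltaMax (q m : ℕ) : ℕ :=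
  if m = 2 ∧ 5 ≤ q then (q ^ 3 - q ^ 2 + q + 3) / (q + 1) + 1
  else (q ^ (m + 1) - q ^ 2 + q + 3) / (q + 1)

/-- `i* = (⌈(q+1)/2⌉·(q^m+1) − [q even])/(q+1)`. -/
def istar (q m : ℕ) : ℕ :=
  ((q + 2) / 2 * (q ^ m + 1) - if Even q then 1 else 0) / (q + 1)

/-- `N₁ = ⌊(δ−(q+1))/q²⌋ + 1`, floor division in `ℤ`. -/
def N1 (q δ : ℕ) : ℤ :=
  ((δ : ℤ) - ((q : ℤ) + 1)).fdiv ((q : ℤ) ^ 2) + 1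

/-- `N₂ = ⌊(q+1)(δ−3)/(q^m−1) − ⌈(q+1)/2⌉⌋` when `q ≥ 5` and
`i*+2+(q^m−1)/(q+1) ≤ δ ≤ δ^max`, and `0` otherwise. -/
def N2 (q m δ : ℕ) : ℤ :=
  if 5 ≤ q ∧ istar q m + 2 + (q ^ m - 1) / (q + 1) ≤ δ ∧ δ ≤ deltaMax q m then
    (((q : ℤ) + 1) * ((δ : ℤ) - 3)).fdiv ((q : ℤ) ^ m - 1) - ((q + 2) / 2 : ℕ)
  else 0

/-- `ι = 1` if `q` is even and `q ≥ 4`, else `0`. -/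
def iota (q : ℕ) : ℤ := if Even q ∧ 4 ≤ q then 1 else 0

/-- The cardinality function `𝒩(q,m,δ)`. -/
def Ncal (q m δ : ℕ) : ℤ :=
  if δ < istar q m + 2 then ((δ : ℤ) - N1 q δ - 1) * m
  else if δ < istar q m + 2 + (q ^ m - 1) / (q + 1) then
    ((δ : ℤ) - N1 q δ - 1) * m - (m / 2 : ℕ) * iota q
  else ((δ : ℤ) - N1 q δ - 1 - N2 q m δ) * m - (m / 2 : ℕ) * iota q

open Polynomial in
/-- The words over `F` of length `n` whose associated polynomial vanishes on `S`. -/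
def zeroCode (F : Type*) {K : Type*} [Field F] [Field K] [Algebra F K] (n : ℕ) (S : Set K) :
    Submodule F (Fin n → F) where
  carrier := {c | ∀ β ∈ S, ∑ k, algebraMap F K (c k) * β ^ (k : ℕ) = 0}
  zero_mem' := by simp
  add_mem' := by
    intro a b ha hb β hβ
    simp only [Pi.add_apply, map_add, add_mul, Finset.sum_add_distrib]
    rw [ha β hβ, hb β hβ, add_zero]
  smul_mem' := by
    intro a b hb β hβ
    simp only [Pi.smul_apply, smul_eq_mul, map_mul, mul_assoc, ← Finset.mul_sum]
    rw [hb β hβ, mul_zero]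

section ZeroCode

variable {F K : Type*} [Field F] [Field K] [Algebra F K] {n : ℕ}

theorem mem_zeroCode {S : Set K} {c : Fin n → F} :
    c ∈ zeroCode F n S ↔ ∀ β ∈ S, ∑ k, algebraMap F K (c k) * β ^ (k : ℕ) = 0 := Iff.rfl

/-- The BCH bound. -/
theorem le_ncard_support_of_mem_zeroCode {S : Set K} {a ζ : K} {δ : ℕ} (ha : a ≠ 0)
    (hζ : Function.Injective fun k : Fin n => ζ ^ (k : ℕ))
    (hS : ∀ j < δ - 1, a * ζ ^ j ∈ S) {c : Fin n → F} (hc : c ∈ zeroCode F n S) (hc0 : c ≠ 0) :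
    δ ≤ {k | c k ≠ 0}.ncard := by
  classical
  by_contra! hlt
  set T : Finset (Fin n) := {k | c k ≠ 0} with hT
  have hcard : {k | c k ≠ 0}.ncard = T.card := by
    rw [← Set.ncard_coe_finset]; simp [hT]
  rw [hcard] at hlt
  let e := T.equivFin.symm
  have key : (fun i : Fin T.card => algebraMap F K (c (e i)) * a ^ ((e i : Fin n) : ℕ)) = 0 := by
    refine Matrix.eq_zero_of_forall_pow_sum_mul_pow_eq_zero
      (f := fun i : Fin T.card => ζ ^ ((e i : Fin n) : ℕ))
      (fun i j hij => e.injective (Subtype.ext (hζ hij))) fun j => ?_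
    have h := hc _ (hS j (by have := j.2; omega))
    rw [← h, ← Finset.sum_subset (Finset.subset_univ T), ← Finset.sum_coe_sort T,
      ← e.sum_comp]
    · exact Finset.sum_congr rfl fun i _ => by ring
    · intro k _ hk
      have : c k = 0 := by simpa [hT] using hk
      simp [this]
  apply hc0
  ext k
  by_contra hk
  have hkT : k ∈ T := by simpa [hT] using hk
  have := congrFun key (e.symm ⟨k, hkT⟩)
  simp [ha] at this
  exact hk this

open Polynomial in
theorem prod_minpoly_dvd_iff [Algebra.IsAlgebraic F K] [DecidableEq F[X]] (S : Finset K)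
    (f : F[X]) : ∏ p ∈ S.image (minpoly F), p ∣ f ↔ ∀ β ∈ S, aeval β f = 0 := by
  constructor
  · intro h β hβ
    refine minpoly.dvd_iff.1 (dvd_trans ?_ h)
    exact Finset.dvd_prod_of_mem (fun p : F[X] => p) (Finset.mem_image_of_mem _ hβ)
  · intro h
    refine Finset.prod_dvd_of_coprime ?_ ?_
    · intro p hp p' hp' hne
      obtain ⟨β, -, rfl⟩ := Finset.mem_image.1 (Finset.mem_coe.1 hp)
      obtain ⟨γ, -, rfl⟩ := Finset.mem_image.1 (Finset.mem_coe.1 hp')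
      have iβ := Algebra.IsIntegral.isIntegral (R := F) β
      have iγ := Algebra.IsIntegral.isIntegral (R := F) γ
      refine (minpoly.irreducible iβ).coprime_iff_not_dvd.2 fun hd => hne ?_
      exact eq_of_monic_of_associated (minpoly.monic iβ) (minpoly.monic iγ)
        ((minpoly.irreducible iβ).associated_of_dvd (minpoly.irreducible iγ) hd)
    · intro p hp
      obtain ⟨β, hβ, rfl⟩ := Finset.mem_image.1 hp
      exact minpoly.dvd_iff.2 (h β hβ)

open Polynomial in
theorem finrank_zeroCode [Algebra.IsAlgebraic F K] [DecidableEq F[X]] (S : Finset K)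
    (hn : (∏ p ∈ S.image (minpoly F), p).natDegree ≤ n) :
    Module.finrank F (zeroCode F n (S : Set K)) =
      n - ∑ p ∈ S.image (minpoly F), p.natDegree := by
  set g := ∏ p ∈ S.image (minpoly F), p with hg
  have hmonic : g.Monic := by
    refine monic_prod_of_monic _ _ fun p hp => ?_
    obtain ⟨β, -, rfl⟩ := Finset.mem_image.1 hp
    exact minpoly.monic (Algebra.IsIntegral.isIntegral β)
  have hdeg : g.natDegree = ∑ p ∈ S.image (minpoly F), p.natDegree := by
    refine natDegree_prod_of_monic _ _ fun p hp => ?_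
    obtain ⟨β, -, rfl⟩ := Finset.mem_image.1 hp
    exact minpoly.monic (Algebra.IsIntegral.isIntegral β)
  have hdvd (f : F[X]) : g ∣ f ↔ ∀ β ∈ S, aeval β f = 0 := prod_minpoly_dvd_iff S f
  let φ : degreeLT F (n - g.natDegree) →ₗ[F] (Fin n → F) :=
    LinearMap.pi fun k => (lcoeff F (k : ℕ)).comp
      ((LinearMap.mulLeft F g).comp (degreeLT F (n - g.natDegree)).subtype)
  have hφ (f : degreeLT F (n - g.natDegree)) (k : Fin n) : φ f k = (g * f.1).coeff k := rfl
  have hlt (f : degreeLT F (n - g.natDegree)) : (g * f.1).degree < n := by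
    rcases eq_or_ne f.1 0 with h0 | h0
    · rw [h0, mul_zero, degree_zero]; exact WithBot.bot_lt_coe n
    · have := mem_degreeLT.1 f.2
      rw [degree_eq_natDegree h0, Nat.cast_lt] at this
      rw [degree_eq_natDegree (mul_ne_zero hmonic.ne_zero h0),
        natDegree_mul hmonic.ne_zero h0, Nat.cast_lt]
      omega
  have hinj : Function.Injective φ := by
    rw [← LinearMap.ker_eq_bot, LinearMap.ker_eq_bot']
    intro f hf
    have h0 : g * f.1 = 0 := by
      ext k
      by_cases hk : k < n
      · simpa [hφ] using congrFun hf ⟨k, hk⟩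
      · rw [coeff_zero]
        exact coeff_eq_zero_of_degree_lt ((hlt f).trans_le (by exact_mod_cast not_lt.1 hk))
    exact Subtype.ext ((mul_eq_zero.1 h0).resolve_left hmonic.ne_zero)
  have hsum (c : Fin n → F) (β : K) :
      aeval β (∑ k : Fin n, C (c k) * X ^ (k : ℕ)) =
        ∑ k, algebraMap F K (c k) * β ^ (k : ℕ) := by
    simp
  have hdl (c : Fin n → F) : (∑ i : Fin n, C (c i) * X ^ (i : ℕ)).degree < (n : WithBot ℕ) := by
    refine (degree_sum_le _ _).trans_lt ((Finset.sup_lt_iff (WithBot.bot_lt_coe n)).2 ?_)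
    intro k _
    exact (degree_C_mul_X_pow_le _ _).trans_lt (WithBot.coe_lt_coe.2 k.2)
  have hrange : LinearMap.range φ = zeroCode F n (S : Set K) := by
    ext c
    rw [mem_zeroCode]
    simp only [← hsum, Finset.mem_coe]
    rw [← hdvd]
    have hcoeff (k : Fin n) : (∑ i : Fin n, C (c i) * X ^ (i : ℕ)).coeff k = c k := by
      simp [coeff_X_pow, Fin.val_inj]
    constructor
    · rintro ⟨f, rfl⟩
      refine ⟨f.1, ?_⟩
      ext k
      by_cases hk : k < n
      · exact hcoeff ⟨k, hk⟩
      · have hk : (n : WithBot ℕ) ≤ k := by exact_mod_cast not_lt.1 hk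
        rw [coeff_eq_zero_of_degree_lt ((hdl _).trans_le hk),
          coeff_eq_zero_of_degree_lt ((hlt f).trans_le hk)]
    · rintro ⟨f, hf⟩
      have hdl := hdl c
      have hfm : f ∈ degreeLT F (n - g.natDegree) := by
        rw [mem_degreeLT]
        rcases eq_or_ne f 0 with h0 | h0
        · rw [h0, degree_zero]; exact WithBot.bot_lt_coe _
        · rw [hf, degree_eq_natDegree (mul_ne_zero hmonic.ne_zero h0),
            natDegree_mul hmonic.ne_zero h0, Nat.cast_lt] at hdl
          rw [degree_eq_natDegree h0, Nat.cast_lt]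
          omega
      refine ⟨⟨f, hfm⟩, funext fun k => ?_⟩
      rw [hφ, ← hf, hcoeff]
  rw [← hrange, LinearMap.finrank_range_of_inj hinj, ← hdeg,
    (degreeLTEquiv F (n - g.natDegree)).finrank_eq, Module.finrank_fin_fun]

open Polynomial in
theorem natDegree_prod_minpoly_le [Algebra.IsAlgebraic F K] [DecidableEq F[X]] (S : Finset K)
    (hn : 0 < n) (η : F) (hS : ∀ β ∈ S, β ^ n = algebraMap F K η) :
    (∏ p ∈ S.image (minpoly F), p).natDegree ≤ n := by
  have hne : (X ^ n - C η : F[X]) ≠ 0 := X_pow_sub_C_ne_zero hn η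
  rw [← natDegree_X_pow_sub_C (n := n) (r := η)]
  refine natDegree_le_of_dvd ((prod_minpoly_dvd_iff S _).2 fun β hβ => ?_) hne
  simp [hS β hβ]

theorem zeroCode_hermitianDual_le {q : ℕ} [Finite K] [Finite F]
    (p e : ℕ) [Fact p.Prime] [CharP K p] (hq : q = p ^ e)
    (hF : Nat.card F = q ^ 2) {S : Set K}
    (hS : ∀ β ∈ S, ∀ γ ∈ S, ∀ t, Odd t → β ^ q ^ t * γ ≠ 1 ∧ (β ^ q ^ t * γ) ^ n = 1)
    {u : Fin n → F} (hu : ∀ v ∈ zeroCode F n S, ∑ k, u k * v k ^ q = 0) :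
    u ∈ zeroCode F n S := by
  intro β hβ
  set m := Module.finrank F K
  have hm : 0 < m := Module.finrank_pos
  have hK (x : K) : x ^ q ^ (2 * m) = x := by
    have : Nat.card K = q ^ (2 * m) := by
      rw [Module.natCard_eq_pow_finrank (K := F), hF, ← pow_mul]
    rw [← this]
    have := Fintype.ofFinite K
    rw [Nat.card_eq_fintype_card, FiniteField.pow_card]
  have hroot (x : K) : (x ^ q ^ (2 * m - 1)) ^ q = x := by
    rw [← pow_mul, ← pow_succ, show 2 * m - 1 + 1 = 2 * m by omega, hK]
  have htr (x : K) : Algebra.trace F K x ^ q = Algebra.trace F K (x ^ q) := by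
    apply (algebraMap F K).injective
    rw [map_pow, FiniteField.algebraMap_trace_eq_sum_pow, FiniteField.algebraMap_trace_eq_sum_pow,
      hq, sum_pow_char_pow]
    exact Finset.sum_congr rfl fun i _ => by rw [← pow_mul, ← pow_mul, mul_comm]
  refine (traceForm_nondegenerate F K).1 _ fun γ => ?_
  rw [Algebra.traceForm_apply]
  let v : Fin n → F := fun k =>
    Algebra.trace F K (γ ^ q ^ (2 * m - 1) * (β ^ q ^ (2 * m - 1)) ^ (k : ℕ))
  have hv : v ∈ zeroCode F n S := by
    intro w hw
    simp only [v, FiniteField.algebraMap_trace_eq_sum_pow, Finset.sum_mul]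
    rw [Finset.sum_comm]
    refine Finset.sum_eq_zero fun i _ => ?_
    obtain ⟨h1, h2⟩ := hS β hβ w hw (2 * m - 1 + 2 * i) ⟨m - 1 + i, by omega⟩
    set ρ := β ^ q ^ (2 * m - 1 + 2 * i) * w with hρ
    have hgeom : ∑ k : Fin n, ρ ^ (k : ℕ) = 0 := by
      rw [Fin.sum_univ_eq_sum_range (fun k => ρ ^ k) n, geom_sum_eq h1, h2]; simp
    rw [← mul_zero ((γ ^ q ^ (2 * m - 1)) ^ Nat.card F ^ i), ← hgeom, Finset.mul_sum]
    refine Finset.sum_congr rfl fun k _ => ?_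
    rw [hρ, hF, ← pow_mul q 2 i, pow_add]
    ring
  have := hu v hv
  simp only [v, htr, mul_pow] at this
  rw [Finset.sum_mul, map_sum, ← this]
  refine Finset.sum_congr rfl fun k _ => ?_
  rw [hroot, ← pow_mul, mul_comm (k : ℕ) q, pow_mul, hroot, mul_assoc, ← Algebra.smul_def,
    map_smul, smul_eq_mul, mul_comm γ]

end ZeroCode


section Exponents

variable {q h : ℕ}

/-- Two exponents below `q ^ (2 * h + 1)` in the same cyclotomic coset, neither divisible by `q ^ 2`,
are equal or arise from each other by exchanging their two digits in base `q ^ (2 * h)`. -/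
theorem eq_or_digits_swap_of_modEq (hq : 2 ≤ q) (hh : 0 < h) {x y i : ℕ}
    (hi : i < 2 * h) (hx : x < q ^ (2 * h + 1)) (hy : y < q ^ (2 * h + 1))
    (hx2 : ¬ q ^ 2 ∣ x) (hy2 : ¬ q ^ 2 ∣ y)
    (hxy : x * q ^ (2 * i) ≡ y [MOD q ^ (4 * h) - 1]) :
    x = y ∨ ∃ a b, 0 < a ∧ a < q ∧ 0 < b ∧ b < q ∧
      x = a + b * q ^ (2 * h) ∧ y = b + a * q ^ (2 * h) := by
  have hq0 : 0 < q := by omega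
  have hx0 : 0 < x := Nat.pos_of_ne_zero fun h0 => hx2 (h0 ▸ dvd_zero _)
  have hy0 : 0 < y := Nat.pos_of_ne_zero fun h0 => hy2 (h0 ▸ dvd_zero _)
  have hlt {z : ℕ} (hz : z < q ^ (2 * h + 1)) : z < q ^ (4 * h) - 1 := by
    have h1 : q ^ (2 * h + 1) * q ≤ q ^ (4 * h) := by
      rw [← pow_succ]; exact Nat.pow_le_pow_right hq0 (by omega)
    have h2 : q ^ (2 * h + 1) * 2 ≤ q ^ (2 * h + 1) * q := Nat.mul_le_mul_left _ hq
    omega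
  obtain ⟨P, hP⟩ : ∃ P, P = q ^ (4 * h - 2 * i) := ⟨_, rfl⟩
  obtain ⟨P', hP'⟩ : ∃ P', P' = q ^ (2 * i) := ⟨_, rfl⟩
  have hPP : P * P' = q ^ (4 * h) := by
    rw [hP, hP', ← pow_add]; congr 1; omega
  have hP0 : 0 < P := by rw [hP]; positivity
  have hP'0 : 0 < P' := by rw [hP']; positivity
  obtain ⟨a, ha⟩ : ∃ a, a = x % P := ⟨_, rfl⟩
  obtain ⟨b, hb⟩ : ∃ b, b = x / P := ⟨_, rfl⟩
  have hxab : x = a + b * P := by rw [ha, hb, mul_comm]; exact (Nat.mod_add_div x P).symm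
  have haP : a < P := ha ▸ Nat.mod_lt _ hP0
  have hbP : b < P' := by
    rw [hb, Nat.div_lt_iff_lt_mul hP0, mul_comm, hPP]
    have := hlt hx; omega
  have hsum : a * P' + b ≡ y [MOD q ^ (4 * h) - 1] := by
    refine Nat.ModEq.trans ?_ hxy
    rw [← hP', hxab, add_mul, mul_assoc, hPP]
    have : q ^ (4 * h) ≡ 1 [MOD q ^ (4 * h) - 1] := by
      have h1 : 1 ≤ q ^ (4 * h) := Nat.one_le_pow _ _ hq0
      exact ((Nat.modEq_iff_dvd' h1).2 dvd_rfl).symm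
    simpa using (Nat.ModEq.refl (a * P')).add ((Nat.ModEq.refl b).mul this.symm)
  have hle : a * P' + b ≤ q ^ (4 * h) - 1 := by
    have : (a + 1) * P' ≤ P * P' := Nat.mul_le_mul_right _ haP
    rw [hPP, add_mul] at this; omega
  have hyab : y = b + a * P' := by
    rcases hle.lt_or_eq with hlt' | heq
    · rw [Nat.ModEq, Nat.mod_eq_of_lt hlt', Nat.mod_eq_of_lt (hlt hy)] at hsum
      omega
    · rw [Nat.ModEq, heq, Nat.mod_self, Nat.mod_eq_of_lt (hlt hy)] at hsum
      omega
  have hPd : q ^ 2 ∣ P := by rw [hP]; exact pow_dvd_pow _ (by omega)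
  have ha0 : 0 < a := Nat.pos_of_ne_zero fun h0 => hx2 (by
    rw [hxab, h0, zero_add]; exact hPd.mul_left _)
  rcases Nat.eq_zero_or_pos i with rfl | hi0
  · left
    have hP1 : P' = 1 := by rw [hP']; simp
    have hb0 : b = 0 := by omega
    rw [hxab, hyab, hb0, hP1]
    ring
  have hP'd : q ^ 2 ∣ P' := by rw [hP']; exact pow_dvd_pow _ (by omega)
  have hb0 : 0 < b := Nat.pos_of_ne_zero fun h0 => hy2 (by
    rw [hyab, h0, zero_add]; exact hP'd.mul_left _)
  have h1 : q ^ (4 * h - 2 * i) < q ^ (2 * h + 1) := by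
    rw [← hP]; nlinarith
  have h2 : q ^ (2 * i) < q ^ (2 * h + 1) := by
    rw [← hP']; nlinarith
  rw [Nat.pow_lt_pow_iff_right hq] at h1 h2
  have hih : i = h := by omega
  subst hih
  rw [show 4 * i - 2 * i = 2 * i by omega] at hP
  have hQ : 0 < q ^ (2 * i) := by positivity
  rw [pow_succ] at hx hy
  rw [hP] at hxab
  rw [hP'] at hyab
  exact Or.inr ⟨a, b, ha0, by nlinarith, hb0, by nlinarith, hxab, hyab⟩

theorem pow_modEq_one (hq : 0 < q) (n : ℕ) : q ^ n ≡ 1 [MOD q ^ n - 1] :=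
  ((Nat.modEq_iff_dvd' (Nat.one_le_pow _ _ hq)).2 dvd_rfl).symm

/-- The cyclotomic cosets of small exponents are disjoint from their Hermitian negatives. -/
theorem not_dvd_add_odd_pow_mul (hq : 0 < q) (hh : 0 < h) {x y z t : ℕ} (hx0 : 0 < x)
    (hy0 : 0 < y) (hxz : x ≤ z) (hyz : y ≤ z) (hz : z * (q ^ (2 * h - 1) + 1) < q ^ (4 * h) - 1)
    (ht : Odd t) : ¬ q ^ (4 * h) - 1 ∣ x + q ^ t * y := by
  have small {x y t : ℕ} (hx0 : 0 < x) (hxz : x ≤ z) (hyz : y ≤ z) (ht : t ≤ 2 * h - 1) :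
      ¬ q ^ (4 * h) - 1 ∣ x + q ^ t * y := by
    refine Nat.not_dvd_of_pos_of_lt (by omega) (lt_of_le_of_lt ?_ hz)
    have h1 : q ^ t * y ≤ q ^ (2 * h - 1) * z :=
      Nat.mul_le_mul (Nat.pow_le_pow_right hq ht) hyz
    linarith
  have hred : q ^ t ≡ q ^ (t % (4 * h)) [MOD q ^ (4 * h) - 1] := by
    conv_lhs => rw [← Nat.div_add_mod t (4 * h), pow_add, pow_mul]
    simpa using ((pow_modEq_one hq (4 * h)).pow (t / (4 * h))).mul_right (q ^ (t % (4 * h)))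
  have hlt : t % (4 * h) < 4 * h := Nat.mod_lt _ (by omega)
  have hodd : t % (4 * h) % 2 = 1 := by
    rw [Nat.mod_mod_of_dvd _ ⟨2 * h, by ring⟩]; exact Nat.odd_iff.1 ht
  intro hd
  generalize t % (4 * h) = s at hred hlt hodd
  have hd' : q ^ (4 * h) - 1 ∣ x + q ^ s * y :=
    (((hred.mul_right y).add_left x).dvd_iff dvd_rfl).1 hd
  rcases le_or_gt s (2 * h - 1) with hs | hs
  · exact small hx0 hxz hyz hs hd'
  · refine small hy0 hyz hxz (t := 4 * h - s) (by omega) ?_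
    refine (Nat.ModEq.dvd_iff ?_ dvd_rfl).1 (hd'.mul_left (q ^ (4 * h - s)))
    rw [mul_add, ← mul_assoc, ← pow_add, Nat.sub_add_cancel hlt.le, add_comm]
    simpa using ((pow_modEq_one hq (4 * h)).mul_right y).add_right (q ^ (4 * h - s) * x)

/-- The exponent `1 + (q + 1) * j` lies in the cyclotomic coset of a smaller one. -/
def IsRedundant (q M j : ℕ) : Prop :=
  q ^ 2 ∣ 1 + (q + 1) * j ∨ ∃ b, (q + 2) / 2 < b ∧ j = b * M + 1

theorem exponent_lt {M J j : ℕ} (hq : 2 ≤ q) (hM : q ^ (2 * h) = (q + 1) * M + 1)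
    (hJ : J + q ≤ q * M + 3) (hj : j < J) : 1 + (q + 1) * j < q ^ (2 * h + 1) := by
  rw [pow_succ, hM]
  nlinarith

theorem not_sq_dvd_digits (hq : 2 ≤ q) (hh : 0 < h) {a b : ℕ} (hb0 : 0 < b) (hb : b < q) :
    ¬ q ^ 2 ∣ b + a * q ^ (2 * h) := by
  intro hd
  have h1 : q ^ 2 ∣ a * q ^ (2 * h) := (pow_dvd_pow q (by omega)).mul_left a
  have := Nat.le_of_dvd hb0 ((Nat.dvd_add_left h1).1 hd)
  nlinarith

theorem exists_not_isRedundant_modEq {M J : ℕ} (hq : 2 ≤ q) (hh : 0 < h)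
    (hM : q ^ (2 * h) = (q + 1) * M + 1) (hJ : J + q ≤ q * M + 3) :
    ∀ j < J, ∃ j' < J, ¬ IsRedundant q M j' ∧
      ∃ i, (1 + (q + 1) * j') * q ^ (2 * i) ≡ 1 + (q + 1) * j [MOD q ^ (4 * h) - 1] := by
  have hM0 : 0 < M := by
    have : 1 < q ^ (2 * h) := Nat.one_lt_pow (by omega) (by omega)
    rcases Nat.eq_zero_or_pos M with rfl | h0
    · omega
    · exact h0
  intro j
  induction j using Nat.strong_induction_on with
  | _ j ih =>
    intro hj
    by_cases hred : IsRedundant q M j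
    swap
    · exact ⟨j, hj, hred, 0, by simp [Nat.ModEq.refl]⟩
    suffices ∃ j' < j, ∃ i,
        (1 + (q + 1) * j') * q ^ (2 * i) ≡ 1 + (q + 1) * j [MOD q ^ (4 * h) - 1] by
      obtain ⟨j', hj', i, hi⟩ := this
      obtain ⟨k, hk, hkr, l, hl⟩ := ih j' hj' (hj'.trans hj)
      refine ⟨k, hk, hkr, l + i, ?_⟩
      rw [mul_add, pow_add, ← mul_assoc]
      exact (hl.mul_right _).trans hi
    rcases hred with ⟨x', hx'⟩ | ⟨b, hb, rfl⟩
    · obtain ⟨r, rfl⟩ : ∃ r, q = r + 1 := ⟨q - 1, by omega⟩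
      have hx0 : 0 < x' := Nat.pos_of_ne_zero fun h0 => by rw [h0] at hx'; omega
      have hle : r * x' ≤ j := by
        by_contra! hlt
        nlinarith
      obtain ⟨k, rfl⟩ := Nat.exists_eq_add_of_le hle
      have hx : 1 + (r + 1 + 1) * k = x' := by nlinarith
      refine ⟨k, by nlinarith, 1, ?_⟩
      rw [hx, hx', mul_one, mul_comm x']
    · have hbq : b < q := by
        by_contra! hle
        have : q * M ≤ b * M := Nat.mul_le_mul_right _ hle
        omega
      obtain ⟨a, ha⟩ : ∃ a, a + b = q + 2 := ⟨q + 2 - b, by omega⟩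
      have hab : a < b := by omega
      refine ⟨a * M + 1, by nlinarith, h, ?_⟩
      have e1 : 1 + (q + 1) * (a * M + 1) = b + a * q ^ (2 * h) := by
        rw [hM]; linarith [show (q + 1) * (a * M + 1) = a * ((q + 1) * M + 1) + (q + 1) - a by
          rw [eq_comm, Nat.sub_eq_iff_eq_add (by omega)]; ring]
      have e2 : 1 + (q + 1) * (b * M + 1) = a + b * q ^ (2 * h) := by
        rw [hM]; linarith [show (q + 1) * (b * M + 1) = b * ((q + 1) * M + 1) + (q + 1) - b by
          rw [eq_comm, Nat.sub_eq_iff_eq_add (by omega)]; ring]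
      rw [e1, e2, add_mul, mul_assoc, ← pow_add, show 2 * h + 2 * h = 4 * h by ring, add_comm]
      simpa using ((pow_modEq_one (by omega) (4 * h)).mul_left a).add_right (b * q ^ (2 * h))

theorem eq_of_modEq_of_not_isRedundant {M J i j j' : ℕ} (hq : 2 ≤ q) (hh : 0 < h)
    (hM : q ^ (2 * h) = (q + 1) * M + 1) (hJ : J + q ≤ q * M + 3) (hj : j < J) (hj' : j' < J)
    (hr : ¬ IsRedundant q M j) (hr' : ¬ IsRedundant q M j')
    (hmod : (1 + (q + 1) * j) * q ^ (2 * i) ≡ 1 + (q + 1) * j' [MOD q ^ (4 * h) - 1]) :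
    j = j' := by
  simp only [IsRedundant, not_or, not_exists, not_and] at hr hr'
  have hi : i % (2 * h) < 2 * h := Nat.mod_lt _ (by omega)
  have hmod' : (1 + (q + 1) * j) * q ^ (2 * (i % (2 * h))) ≡ 1 + (q + 1) * j'
      [MOD q ^ (4 * h) - 1] := by
    refine Nat.ModEq.trans (Nat.ModEq.mul_left _ ?_) hmod
    conv_rhs => rw [← Nat.div_add_mod i (2 * h), mul_add, pow_add, ← mul_assoc, ← mul_assoc,
      show 2 * 2 * h = 4 * h by ring, pow_mul]
    simpa using ((pow_modEq_one (q := q) (by omega) (4 * h)).symm.pow (i / (2 * h))).mul_right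
      (q ^ (2 * (i % (2 * h))))
  rcases eq_or_digits_swap_of_modEq hq hh hi (exponent_lt hq hM hJ hj) (exponent_lt hq hM hJ hj')
    hr.1 hr'.1 hmod' with heq | ⟨a, b, ha0, ha, hb0, hb, hx, hy⟩
  · exact Nat.eq_of_mul_eq_mul_left (by omega : 0 < q + 1) (by omega)
  · rw [hM] at hx hy
    have hab : a + b = q + 2 := by
      have hd : q + 1 ∣ (a + b) + (q + 1) * (b * M) - 1 := ⟨j, by
        rw [Nat.sub_eq_iff_eq_add (by omega)]; linarith⟩
      obtain ⟨c, hc⟩ := hd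
      have hc' : a + b + (q + 1) * (b * M) = (q + 1) * c + 1 := by omega
      obtain ⟨d, rfl⟩ : ∃ d, c = b * M + d := Nat.exists_eq_add_of_le (by nlinarith)
      have hd' : a + b = (q + 1) * d + 1 := by linarith
      have hd1 : 0 < d := Nat.pos_of_ne_zero fun h0 => by rw [h0] at hd'; omega
      have hd2 : d < 2 := by
        by_contra! h2
        have := Nat.mul_le_mul_left (q + 1) h2
        omega
      obtain rfl : d = 1 := by omega
      omega
    have e1 : j = b * M + 1 := Nat.eq_of_mul_eq_mul_left (by omega : 0 < q + 1) (by linarith)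
    have e2 : j' = a * M + 1 := Nat.eq_of_mul_eq_mul_left (by omega : 0 < q + 1) (by linarith)
    have hb' : b ≤ (q + 2) / 2 := not_lt.1 fun hlt => hr.2 b hlt e1
    have ha' : a ≤ (q + 2) / 2 := not_lt.1 fun hlt => hr'.2 a hlt e2
    have : a = b := by omega
    rw [e1, e2, this]

theorem pow_succ_dvd_exponent_iff {M J j : ℕ} (hq : 2 ≤ q)
    (hM : q ^ (2 * h) = (q + 1) * M + 1) (hJ : J + q ≤ q * M + 3) (hj : j < J) :
    q ^ (2 * h) + 1 ∣ 1 + (q + 1) * j ↔ Even q ∧ j = (q + 2) / 2 * M + 1 := by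
  have hlt := exponent_lt hq hM hJ hj
  rw [pow_succ] at hlt
  constructor
  · rintro ⟨c, hc⟩
    have hcq : c < q := by
      by_contra! hle
      nlinarith
    rw [hM] at hc
    have hc0 : 0 < c := Nat.pos_of_ne_zero fun h0 => by rw [h0] at hc; omega
    obtain ⟨d, rfl⟩ : ∃ d, j = c * M + d := Nat.exists_eq_add_of_le (by nlinarith)
    have hd : 1 + (q + 1) * d = 2 * c := by linarith
    have hd0 : 0 < d := Nat.pos_of_ne_zero fun h0 => by rw [h0] at hd; omega
    have hd2 : d < 2 := by
      by_contra! h2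
      have := Nat.mul_le_mul_left (q + 1) h2
      omega
    obtain rfl : d = 1 := by omega
    have : c = (q + 2) / 2 := by omega
    exact ⟨⟨c - 1, by omega⟩, by rw [← this]⟩
  · rintro ⟨⟨r, rfl⟩, rfl⟩
    rw [hM, show (r + r + 2) / 2 = r + 1 by omega]
    exact ⟨r + 1, by ring⟩

theorem sq_dvd_exponent_iff {j : ℕ} (hq : 2 ≤ q) :
    q ^ 2 ∣ 1 + (q + 1) * j ↔ ∃ i, j = q ^ 2 * i + (q - 1) := by
  obtain ⟨r, rfl⟩ : ∃ r, q = r + 1 := ⟨q - 1, by omega⟩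
  constructor
  · rintro ⟨x, hx⟩
    have hx0 : 0 < x := Nat.pos_of_ne_zero fun h0 => by rw [h0] at hx; omega
    have hle : r * x ≤ j := by
      by_contra! hlt
      nlinarith
    obtain ⟨k, rfl⟩ := Nat.exists_eq_add_of_le hle
    have hk : 1 + (r + 1 + 1) * k = x := by nlinarith
    refine ⟨k, ?_⟩
    rw [← hk, Nat.add_sub_cancel]
    ring
  · rintro ⟨i, rfl⟩
    exact ⟨(r + 1 + 1) * i + 1, by rw [Nat.add_sub_cancel]; ring⟩

theorem card_sq_dvd_exponent {J : ℕ} (hq : 2 ≤ q) :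
    (({j ∈ Finset.range J | q ^ 2 ∣ 1 + (q + 1) * j} : Finset ℕ).card : ℤ) = N1 q (J + 1) := by
  have hq2 : 0 < q ^ 2 := by positivity
  have hset : ({j ∈ Finset.range J | q ^ 2 ∣ 1 + (q + 1) * j} : Finset ℕ) =
      (Finset.range ((J + q ^ 2 - q) / q ^ 2)).image fun i => q ^ 2 * i + (q - 1) := by
    ext j
    simp only [Finset.mem_filter, Finset.mem_range, Finset.mem_image, sq_dvd_exponent_iff hq]
    have hqq : q ≤ q ^ 2 := by nlinarith
    have key (i : ℕ) : i < (J + q ^ 2 - q) / q ^ 2 ↔ q ^ 2 * i + (q - 1) < J := by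
      rw [← Nat.succ_le_iff, Nat.le_div_iff_mul_le hq2, Nat.succ_mul, mul_comm]
      omega
    constructor
    · rintro ⟨hj, i, rfl⟩
      exact ⟨i, (key i).2 hj, rfl⟩
    · rintro ⟨i, hi, rfl⟩
      exact ⟨(key i).1 hi, i, rfl⟩
  rw [hset, Finset.card_image_of_injective, Finset.card_range, N1,
    Int.fdiv_eq_ediv_of_nonneg _ (by positivity)]
  · have hqq : q ≤ q ^ 2 := by nlinarith
    push_cast [Nat.cast_sub (show q ≤ J + q ^ 2 by omega)]
    rw [show (J : ℤ) + q ^ 2 - q = J + 1 - (q + 1) + 1 * q ^ 2 by ring,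
      Int.add_mul_ediv_right _ _ (by positivity)]
  · intro a b hab
    exact Nat.eq_of_mul_eq_mul_left hq2 (by simpa using hab)

theorem card_digit_swap {M J s : ℕ} (hM : 0 < M) :
    (open Classical in {j ∈ Finset.range J | ∃ b, s < b ∧ j = b * M + 1}).card =
      (J - 2) / M - s := by
  classical
  have hset : ({j ∈ Finset.range J | ∃ b, s < b ∧ j = b * M + 1} : Finset ℕ) =
      (Finset.Ioc s ((J - 2) / M)).image fun b => b * M + 1 := by
    ext j
    simp only [Finset.mem_filter, Finset.mem_range, Finset.mem_image, Finset.mem_Ioc,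
      Nat.le_div_iff_mul_le hM]
    constructor
    · rintro ⟨hj, b, hb, rfl⟩
      exact ⟨b, ⟨hb, by omega⟩, rfl⟩
    · rintro ⟨b, ⟨hb, hbJ⟩, rfl⟩
      have : 0 < b * M := Nat.mul_pos (by omega) hM
      exact ⟨by omega, b, hb, rfl⟩
  convert (congrArg Finset.card hset).trans ?_
  rw [Finset.card_image_of_injective, Nat.card_Ioc]
  intro a b hab
  exact Nat.eq_of_mul_eq_mul_right hM (by simpa using hab)

theorem istar_eq {M : ℕ} (hM : q ^ (2 * h) = (q + 1) * M + 1) :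
    istar q (2 * h) = (q + 2) / 2 * M + 1 := by
  rw [istar, hM]
  refine Nat.div_eq_of_eq_mul_left (by omega) ?_
  rcases Nat.even_or_odd' q with ⟨r, rfl | rfl⟩
  · rw [if_pos (even_two_mul r), show (2 * r + 2) / 2 = r + 1 by omega]
    rw [Nat.sub_eq_iff_eq_add (Nat.succ_le_of_lt (by positivity))]
    ring
  · rw [if_neg (by simp), show (2 * r + 1 + 2) / 2 = r + 1 by omega]
    rw [Nat.sub_zero]
    ring

open Classical in
theorem sum_coset_sizes {M J : ℕ} (hq : 2 ≤ q) (hh : 0 < h)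
    (hM : q ^ (2 * h) = (q + 1) * M + 1) (hJ : J + q ≤ q * M + 3) (hJ0 : 0 < J)
    (hJmax : J + 1 ≤ deltaMax q (2 * h)) :
    ((∑ j ∈ Finset.range J with ¬ IsRedundant q M j,
      if q ^ (2 * h) + 1 ∣ 1 + (q + 1) * j then h else 2 * h : ℕ) : ℤ) =
      Ncal q (2 * h) (J + 1) := by
  have hM0 : 0 < M := by
    have : 1 < q ^ (2 * h) := Nat.one_lt_pow (by omega) (by omega)
    rcases Nat.eq_zero_or_pos M with rfl | h0
    · omega
    · exact h0
  obtain ⟨s, hs⟩ : ∃ s, s = (q + 2) / 2 := ⟨_, rfl⟩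
  have hred (j : ℕ) : IsRedundant q M j ↔
      q ^ 2 ∣ 1 + (q + 1) * j ∨ ∃ b, s < b ∧ j = b * M + 1 := by rw [hs]; rfl
  have hbq {b : ℕ} (hb : b * M + 1 < J) : b < q := by
    by_contra! hle
    have : q * M ≤ b * M := Nat.mul_le_mul_right _ hle
    omega
  have hdigits {b : ℕ} (hb : b ≤ q + 2) :
      1 + (q + 1) * (b * M + 1) = (q + 2 - b) + b * q ^ (2 * h) := by
    obtain ⟨a, ha⟩ := Nat.exists_eq_add_of_le hb
    rw [hM, ha, Nat.add_sub_cancel_left]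
    nlinarith
  have hsplit : J = ({j ∈ Finset.range J | ¬ IsRedundant q M j} : Finset ℕ).card +
      (({j ∈ Finset.range J | q ^ 2 ∣ 1 + (q + 1) * j} : Finset ℕ).card +
        ({j ∈ Finset.range J | ∃ b, s < b ∧ j = b * M + 1} : Finset ℕ).card) := by
    rw [← Finset.card_union_of_disjoint, ← Finset.filter_or, add_comm]
    · simp only [← hred]
      rw [Finset.card_filter_add_card_filter_not, Finset.card_range]
    · rw [Finset.disjoint_filter]
      rintro j hj hd ⟨b, hb, rfl⟩
      have hbq := hbq (Finset.mem_range.1 hj)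
      rw [hdigits (by omega)] at hd
      exact not_sq_dvd_digits hq hh (by omega) (by omega) hd
  have hhalf : ({j ∈ {j ∈ Finset.range J | ¬ IsRedundant q M j} |
      q ^ (2 * h) + 1 ∣ 1 + (q + 1) * j} : Finset ℕ).card =
        if Even q ∧ s * M + 1 < J then 1 else 0 := by
    split_ifs with hc
    · rw [Finset.card_eq_one]
      refine ⟨s * M + 1, ?_⟩
      ext j
      simp only [Finset.mem_filter, Finset.mem_range, Finset.mem_singleton]
      constructor
      · rintro ⟨⟨hj, -⟩, hd⟩
        rw [hs]
        exact ((pow_succ_dvd_exponent_iff hq hM hJ hj).1 hd).2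
      · rintro rfl
        refine ⟨⟨hc.2, ?_⟩, (pow_succ_dvd_exponent_iff hq hM hJ hc.2).2 ⟨hc.1, by rw [hs]⟩⟩
        rw [hred]
        have hsq := hbq hc.2
        obtain ⟨t, ht⟩ := hc.1
        rintro (hd | ⟨b, hb, hbs⟩)
        · rw [hdigits (by omega)] at hd
          exact not_sq_dvd_digits hq hh (by omega) (by omega) hd
        · have : s = b := Nat.eq_of_mul_eq_mul_right hM0 (by omega)
          omega
    · rw [Finset.card_eq_zero, Finset.filter_eq_empty_iff]
      intro j hj hd
      rw [Finset.mem_filter, Finset.mem_range] at hj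
      obtain ⟨h1, h2⟩ := (pow_succ_dvd_exponent_iff hq hM hJ hj.1).1 hd
      rw [← hs] at h2
      exact hc ⟨h1, h2 ▸ hj.1⟩
  have hsum : (∑ j ∈ Finset.range J with ¬ IsRedundant q M j,
      if q ^ (2 * h) + 1 ∣ 1 + (q + 1) * j then h else 2 * h) +
        h * (if Even q ∧ s * M + 1 < J then 1 else 0) =
      ({j ∈ Finset.range J | ¬ IsRedundant q M j} : Finset ℕ).card * (2 * h) := by
    rw [← hhalf, Finset.card_filter _ {j ∈ Finset.range J | ¬ IsRedundant q M j}, Finset.mul_sum,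
      ← Finset.sum_add_distrib, ← smul_eq_mul (a := Finset.card _), ← Finset.sum_const]
    refine Finset.sum_congr rfl fun j _ => ?_
    split_ifs <;> ring
  have hN1 := card_sq_dvd_exponent (J := J) hq
  rw [card_digit_swap hM0] at hsplit
  generalize (∑ j ∈ Finset.range J with ¬ IsRedundant q M j,
      if q ^ (2 * h) + 1 ∣ 1 + (q + 1) * j then h else 2 * h) = σ at *
  generalize ({j ∈ Finset.range J | ¬ IsRedundant q M j} : Finset ℕ).card = r at *
  generalize ({j ∈ Finset.range J | q ^ 2 ∣ 1 + (q + 1) * j} : Finset ℕ).card = d at *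
  have hMi : ((q : ℤ) ^ (2 * h)) = (q + 1) * M + 1 := by exact_mod_cast hM
  have hdiv : (q ^ (2 * h) - 1) / (q + 1) = M := by
    rw [hM, Nat.add_sub_cancel, Nat.mul_div_cancel_left _ (by omega)]
  rw [Ncal, istar_eq hM, hdiv, ← hs, ← hN1, Nat.mul_div_cancel_left _ (by omega : 0 < 2)]
  have hiota : s * M + 2 ≤ J →
      (h : ℤ) * iota q = h * (if Even q ∧ s * M + 1 < J then 1 else 0) := by
    intro hsJ
    have : s < q := hbq hsJ
    rw [iota]
    congr 1
    refine if_congr (and_congr_right fun he => ?_) rfl rfl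
    have : q ≠ 2 := by omega
    obtain ⟨t, rfl⟩ := he
    omega
  have hσ : (σ : ℤ) + h * (if Even q ∧ s * M + 1 < J then 1 else 0) = r * (2 * h) := by
    exact_mod_cast hsum
  split_ifs with c1 c2
  · rw [if_neg (by omega)] at hσ
    have : (J - 2) / M - s = 0 := by
      rw [Nat.sub_eq_zero_iff_le, ← Nat.lt_succ_iff, Nat.div_lt_iff_lt_mul hM0, Nat.succ_mul]
      omega
    rw [this, add_zero] at hsplit
    rw [hsplit]
    push_cast
    linarith
  · rw [hiota (by omega)]
    generalize (if Even q ∧ s * M + 1 < J then (1 : ℤ) else 0) = ε at *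
    have : (J - 2) / M - s = 0 := by
      rw [Nat.sub_eq_zero_iff_le, ← Nat.lt_succ_iff, Nat.div_lt_iff_lt_mul hM0, Nat.succ_mul]
      omega
    rw [this, add_zero] at hsplit
    rw [hsplit]
    push_cast
    linarith
  · rw [hiota (by omega)]
    have hle : s + 1 ≤ (J - 2) / M := by
      rw [Nat.le_div_iff_mul_le hM0, add_mul]
      omega
    have hsq : s + 1 < q := hbq (by rw [add_mul]; omega)
    have hN2 : N2 q (2 * h) (J + 1) = ((J - 2) / M - s : ℕ) := by
      rw [N2, if_pos ⟨by omega, by rw [istar_eq hM, hdiv, ← hs]; omega, hJmax⟩,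
        Int.fdiv_eq_ediv_of_nonneg _ (by rw [hMi, add_sub_cancel_right]; positivity), hMi,
        add_sub_cancel_right,
        Int.mul_ediv_mul_of_pos _ _ (by positivity), ← hs]
      push_cast [Nat.cast_sub (show s ≤ (J - 2) / M by omega),
        Nat.cast_sub (show 2 ≤ J by omega)]
      ring_nf
    rw [hN2]
    generalize (if Even q ∧ s * M + 1 < J then (1 : ℤ) else 0) = ε at *
    generalize (J - 2) / M - s = w at *
    rw [hsplit]
    push_cast
    linarith

theorem bounds_of_le_deltaMax {M δ : ℕ} (hq : 2 ≤ q) (hh : 0 < h)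
    (hM : q ^ (2 * h) = (q + 1) * M + 1) (hδ : 2 ≤ δ) (hmax : δ ≤ deltaMax q (2 * h)) :
    δ - 1 + q ≤ q * M + 3 ∧
      (1 + (q + 1) * (δ - 2)) * (q ^ (2 * h - 1) + 1) < q ^ (4 * h) - 1 := by
  obtain ⟨W, hW⟩ : ∃ W, W = q ^ (2 * h - 1) := ⟨_, rfl⟩
  have hqW : q ^ (2 * h) = q * W := by
    rw [hW, ← pow_succ']; congr 1; omega
  have hQ2 : q ^ (4 * h) = (q * W) ^ 2 := by rw [← hqW, ← pow_mul]; congr 1; omega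
  have hWq : q ≤ W := by
    rw [hW]; exact Nat.le_self_pow (by omega) q
  have hM1 : q ≤ M + 1 := by
    by_contra! hlt
    nlinarith
  have hqM : q ≤ q * M + 3 := by nlinarith
  obtain ⟨k, hk⟩ : ∃ k, q * M + 3 = q + k := Nat.exists_eq_add_of_le hqM
  have hquot : (q ^ (2 * h + 1) - q ^ 2 + q + 3) / (q + 1) = k := by
    refine Nat.div_eq_of_eq_mul_left (by omega) ?_
    have : q ^ 2 ≤ q ^ (2 * h + 1) := Nat.pow_le_pow_right (by omega) (by omega)
    rw [← Nat.add_right_cancel_iff (n := q ^ 2),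
      show q ^ (2 * h + 1) - q ^ 2 + q + 3 + q ^ 2 = q ^ (2 * h + 1) + q + 3 by omega,
      pow_succ, hM]
    nlinarith
  obtain ⟨j, rfl⟩ : ∃ j, δ = j + 2 := ⟨δ - 2, by omega⟩
  rw [Nat.add_sub_cancel, hQ2, ← hW]
  rw [deltaMax] at hmax
  split_ifs at hmax with hc
  · obtain rfl : h = 1 := by omega
    have hWq' : W = q := by rw [hW]; simp
    subst hWq'
    rw [show W ^ 3 = W ^ (2 * 1 + 1) by norm_num, hquot] at hmax
    refine ⟨by omega, ?_⟩
    obtain rfl : W = M + 1 := by nlinarith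
    rw [Nat.lt_sub_iff_add_lt]
    have hj : j ≤ M ^ 2 + 1 := by nlinarith
    have hj' : 1 + (M + 1 + 1) * j ≤ 1 + (M + 1 + 1) * (M ^ 2 + 1) := by gcongr
    have := Nat.mul_le_mul_right (M + 1 + 1) hj'
    nlinarith
  · rw [hquot] at hmax
    refine ⟨by omega, ?_⟩
    have hj : j + q ≤ q * M + 1 := by omega
    rw [Nat.lt_sub_iff_add_lt]
    rw [hqW] at hM
    have : 1 + (q + 1) * j + q ^ 2 + q ≤ q * (q * W) + 2 := by
      rw [hM]; nlinarith
    have := Nat.mul_le_mul_right (W + 1) this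
    nlinarith

end Exponents

section CyclotomicCosets

variable {F K : Type*} [Field F] [Field K] [Algebra F K] [Finite F] {q h : ℕ} {α : K}

theorem exists_modEq_of_minpoly_eq [Finite K] (hF : Nat.card F = q ^ 2) (hα0 : α ≠ 0)
    {x y : ℕ} (hxy : minpoly F (α ^ y) = minpoly F (α ^ x)) :
    ∃ i, x * q ^ (2 * i) ≡ y [MOD orderOf α] := by
  obtain ⟨p, hp⟩ := CharP.exists F
  have : Fact p.Prime := ⟨CharP.char_is_prime F p⟩
  obtain ⟨g, hg⟩ := (Normal.minpoly_eq_iff_mem_orbit K).1 hxy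
  obtain ⟨i, hi⟩ := FiniteField.exists_forall_apply_eq_pow F p K g
  refine ⟨i, ?_⟩
  have hg' : g (α ^ x) = α ^ y := hg
  have := isOfFinOrder_of_finite (Units.mk0 α hα0)
  rw [hi, hF, ← pow_mul, ← pow_mul] at hg'
  have h1 : Units.mk0 α hα0 ^ (x * q ^ (2 * i)) = Units.mk0 α hα0 ^ y := Units.ext hg'
  rw [pow_eq_pow_iff_modEq, ← orderOf_units] at h1
  exact h1

theorem minpoly_pow_eq_of_modEq (hF : Nat.card F = q ^ 2) {x y i : ℕ}
    (hxy : x * q ^ (2 * i) ≡ y [MOD orderOf α]) : minpoly F (α ^ x) = minpoly F (α ^ y) := by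
  have := Fintype.ofFinite F
  have hpow : (FiniteField.frobeniusAlgHom F K ^ i) (α ^ x) = α ^ y := by
    rw [← pow_mod_orderOf α y, ← show _ % _ = _ % _ from hxy, pow_mod_orderOf,
      AlgHom.coe_pow, FiniteField.coe_frobeniusAlgHom, pow_iterate,
      ← Nat.card_eq_fintype_card, hF, ← pow_mul]
    exact (pow_mul _ _ _).symm
  rw [← hpow]
  exact (minpoly.algHom_eq _ (RingHom.injective _) _).symm

open Polynomial in
theorem natDegree_minpoly_dvd_iff [Finite K] (hF : Nat.card F = q ^ 2) (hα0 : α ≠ 0) {x d : ℕ} :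
    (minpoly F (α ^ x)).natDegree ∣ d ↔ x * q ^ (2 * d) ≡ x [MOD orderOf α] := by
  have hint := Algebra.IsIntegral.isIntegral (R := F) (α ^ x)
  rw [(minpoly.irreducible hint).natDegree_dvd_iff_dvd_X_pow_card_pow_sub_X, minpoly.dvd_iff,
    hF, map_sub, map_pow, aeval_X, sub_eq_zero, ← pow_mul, ← pow_mul]
  have h1 : α ^ (x * q ^ (2 * d)) = α ^ x ↔
      Units.mk0 α hα0 ^ (x * q ^ (2 * d)) = Units.mk0 α hα0 ^ x := by
    rw [Units.ext_iff]; rfl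
  rw [h1, pow_eq_pow_iff_modEq, ← orderOf_units]
  rfl

theorem natDegree_minpoly_pow [Finite K] (hF : Nat.card F = q ^ 2) (hq : 2 ≤ q) (hh : 0 < h)
    (hα0 : α ≠ 0) (hα : orderOf α = q ^ (4 * h) - 1) {x : ℕ} (hx0 : 0 < x)
    (hx : x < q ^ (2 * h + 1)) :
    (minpoly F (α ^ x)).natDegree = if q ^ (2 * h) + 1 ∣ x then h else 2 * h := by
  set D := (minpoly F (α ^ x)).natDegree with hD
  have hdvd {d : ℕ} : D ∣ d ↔ x * q ^ (2 * d) ≡ x [MOD q ^ (4 * h) - 1] := by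
    rw [← hα]; exact natDegree_minpoly_dvd_iff hF hα0
  have hQ : 1 < q ^ (2 * h) := Nat.one_lt_pow (by omega) (by omega)
  have hmul : q ^ (4 * h) - 1 = (q ^ (2 * h) + 1) * (q ^ (2 * h) - 1) := by
    rw [← Nat.sq_sub_sq, ← pow_mul, one_pow]; congr 2; ring
  have hhalf : D ∣ h ↔ q ^ (2 * h) + 1 ∣ x := by
    rw [hdvd, Nat.ModEq.comm, Nat.modEq_iff_dvd' (Nat.le_mul_of_pos_right _ (by omega)), hmul,
      ← Nat.mul_sub_one, Nat.mul_dvd_mul_iff_right (by omega)]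
  have hfull : D ∣ 2 * h := by
    rw [hdvd, ← mul_assoc]
    simpa using (pow_modEq_one (q := q) (by omega) (4 * h)).mul_left x
  have hD0 : 0 < D := Nat.pos_of_dvd_of_pos hfull (by omega)
  have hge : h ≤ D := by
    by_contra! hlt
    have h1 := hdvd.1 (dvd_refl D)
    have h2 : 1 < q ^ (2 * D) := Nat.one_lt_pow (by omega) (by omega)
    rw [Nat.ModEq.comm, Nat.modEq_iff_dvd' (Nat.le_mul_of_pos_right _ (by omega))] at h1
    have h3 : x < x * q ^ (2 * D) := by nlinarith
    refine Nat.not_dvd_of_pos_of_lt (by omega) ?_ h1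
    have h4 : x * q ^ (2 * D) < q ^ (2 * h + 1) * q ^ (2 * D) :=
      Nat.mul_lt_mul_of_pos_right hx (by omega)
    have h5 : q ^ (2 * h + 1) * q ^ (2 * D) ≤ q ^ (4 * h) := by
      rw [← pow_add]; exact Nat.pow_le_pow_right (by omega) (by omega)
    omega
  split_ifs with hc
  · exact le_antisymm (Nat.le_of_dvd hh (hhalf.2 hc)) hge
  · obtain ⟨c, hc'⟩ := hfull
    have hc0 : 0 < c := Nat.pos_of_ne_zero fun h0 => by rw [h0] at hc'; omega
    have hc2 : c ≤ 2 := by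
      by_contra! h3
      have := Nat.mul_le_mul_left D h3
      omega
    interval_cases c
    · omega
    · exact absurd (hhalf.1 ⟨1, by omega⟩) hc

end CyclotomicCosets

theorem stmt13 (q m p e : ℕ) (hp : p.Prime) (he : 0 < e) (hqpe : q = p ^ e)
    (hm : 2 ≤ m) (hme : Even m)
    (δ : ℕ) (hδ : 2 ≤ δ) (hδmax : δ ≤ deltaMax q m)
    (F : Type) [Field F] [Fintype F] (hF : Fintype.card F = q ^ 2) :
    ∃ C : Submodule F (Fin ((q ^ (2 * m) - 1) / (q + 1)) → F),
      ((Module.finrank F C : ℤ) = ((q ^ (2 * m) - 1) / (q + 1) : ℕ) - Ncal q m δ) ∧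
      (∀ u : Fin ((q ^ (2 * m) - 1) / (q + 1)) → F,
        (∀ v ∈ C, ∑ k, u k * (v k) ^ q = 0) → u ∈ C) ∧
      (∀ v ∈ C, v ≠ 0 → δ ≤ {k | v k ≠ 0}.ncard) := by
  classical
  obtain ⟨h, rfl⟩ : ∃ h, m = 2 * h := by obtain ⟨h, rfl⟩ := hme; exact ⟨h, by ring⟩
  have hh : 0 < h := by omega
  have : Fact p.Prime := ⟨hp⟩
  have hq2 : 2 ≤ q := by
    rw [hqpe]; exact hp.two_le.trans (Nat.le_self_pow (by omega) p)
  have hFc : Nat.card F = q ^ 2 := by rw [Nat.card_eq_fintype_card, hF]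
  have : CharP F p := by
    refine charP_of_card_eq_prime_pow (f := e * 2) ?_
    rw [hF, hqpe, pow_mul]
  have : NeZero (2 * h) := ⟨by omega⟩
  let K := FiniteField.Extension F p (2 * h)
  have hKc : Nat.card K = q ^ (4 * h) := by
    rw [FiniteField.natCard_extension, hFc, ← pow_mul]; congr 1; ring
  have : CharP K p := charP_of_injective_algebraMap (algebraMap F K).injective p
  obtain ⟨M, hM⟩ : ∃ M, q ^ (2 * h) = (q + 1) * M + 1 := by
    have h1 : q + 1 ∣ q ^ (2 * h) - 1 := by
      have h2 : q + 1 ∣ q ^ 2 - 1 := ⟨q - 1, by rw [← Nat.sq_sub_sq, one_pow]⟩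
      refine h2.trans ?_
      have := Nat.sub_dvd_pow_sub_pow (q ^ 2) 1 h
      rwa [one_pow, ← pow_mul] at this
    obtain ⟨M, hM⟩ := h1
    have : 1 ≤ q ^ (2 * h) := Nat.one_le_pow _ _ (by omega)
    exact ⟨M, by omega⟩
  obtain ⟨hJ, hz⟩ := bounds_of_le_deltaMax hq2 hh hM hδ hδmax
  obtain ⟨n, hn⟩ : ∃ n, n = (q ^ (2 * (2 * h)) - 1) / (q + 1) := ⟨_, rfl⟩
  have hnN : (q + 1) * n = q ^ (4 * h) - 1 := by
    rw [hn]
    rw [show 2 * (2 * h) = 2 * h * 2 by ring, show 4 * h = 2 * h * 2 by ring, pow_mul, hM]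
    refine Nat.mul_div_cancel' ⟨M * ((q + 1) * M + 2), ?_⟩
    rw [Nat.sub_eq_iff_eq_add (Nat.one_le_pow _ _ (by omega))]
    ring
  rw [← hn]
  have hN2 : 1 < q ^ (4 * h) := Nat.one_lt_pow (by omega) (by omega)
  have hn0 : 0 < n := Nat.pos_of_ne_zero fun h0 => by rw [h0] at hnN; omega
  obtain ⟨g, hg⟩ := IsCyclic.exists_ofOrder_eq_natCard (α := Kˣ)
  have hα : orderOf (g : K) = q ^ (4 * h) - 1 := by
    rw [orderOf_units, hg, Nat.card_units, hKc]
  obtain ⟨α, hgα⟩ : ∃ α : K, α = g := ⟨_, rfl⟩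
  have hα0 : α ≠ 0 := hgα ▸ g.ne_zero
  rw [← hgα] at hα
  have hαn : α ^ ((q + 1) * n) = 1 := by rw [hnN, ← hα, pow_orderOf_eq_one]
  let f : ℕ → K := fun j => α ^ (1 + (q + 1) * j)
  let S : Finset K := (Finset.range (δ - 1)).image f
  let R : Finset ℕ := {j ∈ Finset.range (δ - 1) | ¬ IsRedundant q M j}
  refine ⟨zeroCode F n (S : Set K), ?_, ?_, ?_⟩
  · have hη : ∃ η : F, algebraMap F K η = α ^ n := by
      rw [← RingHom.mem_range, ← minpoly.natDegree_eq_one_iff, ← Nat.dvd_one,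
        natDegree_minpoly_dvd_iff hFc hα0, hα, Nat.ModEq.comm,
        Nat.modEq_iff_dvd' (Nat.le_mul_of_pos_right _ (by positivity)), ← Nat.mul_sub_one, mul_one]
      refine ⟨q - 1, ?_⟩
      rw [← hnN, ← one_pow 2, Nat.sq_sub_sq, one_pow]
      ring
    obtain ⟨η, hη⟩ := hη
    have hle : (∏ p ∈ S.image (minpoly F), p).natDegree ≤ n := by
      refine natDegree_prod_minpoly_le S hn0 η fun β hβ => ?_
      obtain ⟨j, -, rfl⟩ := Finset.mem_image.1 hβ
      rw [hη, ← pow_mul, add_mul, one_mul, pow_add, mul_right_comm, pow_mul, hαn, one_pow, mul_one]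
    have himage : S.image (minpoly F) = R.image (fun j => minpoly F (f j)) := by
      ext P
      simp only [S, R, Finset.mem_image, Finset.mem_filter, Finset.mem_range]
      constructor
      · rintro ⟨_, ⟨j, hj, rfl⟩, rfl⟩
        obtain ⟨j', hj', hr, i, hi⟩ := exists_not_isRedundant_modEq hq2 hh hM hJ j hj
        exact ⟨j', ⟨hj', hr⟩, minpoly_pow_eq_of_modEq hFc (hα ▸ hi)⟩
      · rintro ⟨j, hj, rfl⟩
        exact ⟨f j, ⟨j, hj.1, rfl⟩, rfl⟩
    have hsum : ∑ P ∈ S.image (minpoly F), P.natDegree =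
        ∑ j ∈ R, if q ^ (2 * h) + 1 ∣ 1 + (q + 1) * j then h else 2 * h := by
      rw [himage, Finset.sum_image]
      · refine Finset.sum_congr rfl fun j hj => ?_
        have hj := Finset.mem_range.1 (Finset.mem_filter.1 hj).1
        exact natDegree_minpoly_pow hFc hq2 hh hα0 hα (by omega) (exponent_lt hq2 hM hJ hj)
      · intro j hj j' hj' heq
        simp only [R, Finset.coe_filter, Finset.mem_range, Set.mem_ofPred_eq] at hj hj'
        obtain ⟨i, hi⟩ := exists_modEq_of_minpoly_eq hFc hα0 heq
        exact (eq_of_modEq_of_not_isRedundant hq2 hh hM hJ hj'.1 hj.1 hj'.2 hj.2 (hα ▸ hi)).symm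
    have hsizes := sum_coset_sizes hq2 hh hM hJ (by omega)
      (by rwa [Nat.sub_add_cancel (by omega)])
    rw [Nat.sub_add_cancel (by omega)] at hsizes
    have hdeg : (∏ p ∈ S.image (minpoly F), p).natDegree =
        ∑ P ∈ S.image (minpoly F), P.natDegree := by
      refine Polynomial.natDegree_prod_of_monic _ _ fun p hp => ?_
      obtain ⟨β, -, rfl⟩ := Finset.mem_image.1 hp
      exact minpoly.monic (Algebra.IsIntegral.isIntegral β)
    rw [finrank_zeroCode S hle, Nat.cast_sub (hdeg ▸ hle), hsum, hsizes]
  · intro u hu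
    refine zeroCode_hermitianDual_le p e hqpe hFc ?_ hu
    rintro _ hβ _ hγ t ht
    obtain ⟨j, hj, rfl⟩ := Finset.mem_image.1 (Finset.mem_coe.1 hβ)
    obtain ⟨k, hk, rfl⟩ := Finset.mem_image.1 (Finset.mem_coe.1 hγ)
    rw [Finset.mem_range] at hj hk
    have hexp : f j ^ q ^ t * f k = α ^ (1 + (q + 1) * k + q ^ t * (1 + (q + 1) * j)) := by
      simp only [f]; rw [← pow_mul, ← pow_add]; congr 1; ring
    rw [hexp]
    constructor
    · rw [Ne, ← orderOf_dvd_iff_pow_eq_one, hα]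
      exact not_dvd_add_odd_pow_mul (by omega) hh (by omega) (by omega)
        (z := 1 + (q + 1) * (δ - 2)) (by gcongr; omega) (by gcongr; omega) hz ht
    · have hd : q + 1 ∣ 1 + (q + 1) * k + q ^ t * (1 + (q + 1) * j) := by
        have h1 : q + 1 ∣ q ^ t + 1 := by simpa using ht.nat_add_dvd_pow_add_pow q 1
        rw [show 1 + (q + 1) * k + q ^ t * (1 + (q + 1) * j) =
          (q ^ t + 1) + (q + 1) * (k + q ^ t * j) by ring]
        exact h1.add (Dvd.intro _ rfl)
      obtain ⟨c, hc⟩ := hd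
      rw [hc, ← pow_mul, mul_right_comm, pow_mul, hαn, one_pow]
  · intro v hv hv0
    refine le_ncard_support_of_mem_zeroCode hα0 (ζ := α ^ (q + 1)) ?_ (fun j hj => ?_) hv hv0
    · intro j k hjk
      simp only [← pow_mul] at hjk
      have hlt (i : Fin n) : (q + 1) * i < orderOf α := by
        rw [hα, ← hnN]; exact Nat.mul_lt_mul_of_pos_left i.2 (by omega)
      have := pow_injOn_Iio_orderOf (hlt j) (hlt k) hjk
      exact Fin.ext (Nat.eq_of_mul_eq_mul_left (by omega) this)
    · refine Finset.mem_coe.2 (Finset.mem_image.2 ⟨j, Finset.mem_range.2 hj, ?_⟩)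
      simp only [f]
      rw [pow_add, pow_one, pow_mul]
end

section
/- Let q be a prime power, m ≥ 2 an even integer, and r = q+1. For every integer w with 2 ≤ w ≤ q−1, setting i = w·(q^m−1)/(q+1) + 1 and ī = q^m − (w−1)·(q^m−1)/(q+1), one has q^m·(1+r·i) ≡ 1+r·ī (mod q^{2m}−1); consequently the q²-cyclotomic cosets modulo q^{2m}−1 satisfy C_{1+r·i} = C_{1+r·ī}. -/
/-- The q²-cyclotomic coset of `s` modulo `M`, viewed inside `ZMod M`. -/
def coset (q M s : ℕ) : Set (ZMod M) :=
  {x | ∃ l : ℕ, x = (s : ZMod M) * (q : ZMod M) ^ (2 * l)}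

/-- `q + 1` divides `q ^ m - 1` when `m` is even. -/
theorem succ_dvd_pow_sub_one_of_even (q : ℕ) {m : ℕ} (hm : Even m) :
    q + 1 ∣ q ^ m - 1 := by
  obtain ⟨k, rfl⟩ := hm
  have h : q ^ 2 - 1 ∣ (q ^ 2) ^ k - 1 := by
    simpa using Nat.sub_dvd_pow_sub_pow (q ^ 2) 1 k
  rw [← two_mul, pow_mul]
  refine Dvd.dvd.trans ⟨q - 1, ?_⟩ h
  simpa using Nat.sq_sub_sq q 1

/-- In `ZMod (q ^ n - 1)` the `n`-th power of `q` is `1`. -/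
theorem natCast_pow_eq_one (q n : ℕ) (hq : 0 < q) :
    (q : ZMod (q ^ n - 1)) ^ n = 1 := by
  have h : ((q ^ n - 1 : ℕ) : ZMod (q ^ n - 1)) = 0 := ZMod.natCast_self _
  rw [Nat.cast_sub (Nat.one_le_pow _ _ hq)] at h
  push_cast at h
  exact sub_eq_zero.mp h

/-- Multiplying by `q ^ m` with `m` even does not change the coset modulo `q ^ (2 * m) - 1`. -/
theorem coset_eq_of_pow_mul_modEq {q m s t : ℕ} (hq : 0 < q) (hm : Even m)
    (h : q ^ m * s ≡ t [MOD q ^ (2 * m) - 1]) :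
    coset q (q ^ (2 * m) - 1) s = coset q (q ^ (2 * m) - 1) t := by
  have ht := (ZMod.natCast_eq_natCast_iff _ _ _).mpr h
  have hone := natCast_pow_eq_one q (2 * m) hq
  push_cast at ht
  obtain ⟨k, rfl⟩ := hm
  ext x
  constructor
  · rintro ⟨l, rfl⟩
    refine ⟨k + l, ?_⟩
    rw [← ht]
    linear_combination -((s : ZMod (q ^ (2 * (k + k)) - 1)) * (q : ZMod _) ^ (2 * l)) * hone
  · rintro ⟨l, rfl⟩
    refine ⟨k + l, ?_⟩
    rw [← ht]
    ring

theorem stmt14 (q m : ℕ) (hq : IsPrimePow q) (hm : 2 ≤ m) (hme : Even m)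
    (r : ℕ) (hr : r = q + 1)
    (w : ℕ) (hw1 : 2 ≤ w) (hw2 : w ≤ q - 1)
    (i ibar : ℕ) (hi : i = w * ((q ^ m - 1) / (q + 1)) + 1)
    (hibar : ibar = q ^ m - (w - 1) * ((q ^ m - 1) / (q + 1))) :
    q ^ m * (1 + r * i) ≡ 1 + r * ibar [MOD q ^ (2 * m) - 1] ∧
    coset q (q ^ (2 * m) - 1) (1 + r * i) = coset q (q ^ (2 * m) - 1) (1 + r * ibar) := by
  have hq0 : 0 < q := hq.pos
  have key : q ^ m * (1 + r * i) ≡ 1 + r * ibar [MOD q ^ (2 * m) - 1] := by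
    have hA := Nat.mul_div_cancel' (succ_dvd_pow_sub_one_of_even q hme)
    have hQ : 1 ≤ q ^ m := Nat.one_le_pow _ _ hq0
    rw [mul_comm 2 m, pow_mul]
    generalize (q ^ m - 1) / (q + 1) = A at *
    generalize q ^ m = Q at *
    have hle : (w - 1) * A ≤ Q := by
      have : (w - 1) * A ≤ (q + 1) * A := Nat.mul_le_mul_right A (by omega)
      omega
    subst hr hi hibar
    rw [← Int.natCast_modEq_iff]
    refine (Int.modEq_iff_dvd.mpr ⟨-(w : ℤ), ?_⟩)
    zify [hQ] at hA
    rw [Nat.cast_sub (Nat.one_le_pow _ _ hQ)]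
    push_cast [Nat.cast_sub hle, Nat.cast_sub (show 1 ≤ w by omega)]
    linear_combination (-(w : ℤ) + 1 - Q * w) * hA
  exact ⟨key, coset_eq_of_pow_mul_modEq hq0 hme key⟩
end

section
/- Let q be a prime power, m ≥ 2 an even integer, and r = q+1. Suppose i and ī are integers with 0 ≤ i < ī ≤ δ^max − 2 such that the q²-cyclotomic cosets modulo q^{2m}−1 satisfy C_{1+r·i} = C_{1+r·ī}. Then either ī ≡ q−1 (mod q²), or there exists an integer w with 2 ≤ w ≤ q−1 such that i = w·(q^m−1)/(q+1) + 1 and ī = q^m − (w−1)·(q^m−1)/(q+1). -/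
/-- A congruence `t ≡ s * q ^ k` modulo `q ^ n - 1` can be solved for `s`. -/
lemma mul_pow_modEq_of_pow_modEq {q n s t k : ℕ} (hq : 1 ≤ q) (hk : k ≤ n)
    (h : t ≡ s * q ^ k [MOD q ^ n - 1]) : s ≡ t * q ^ (n - k) [MOD q ^ n - 1] := by
  have h1 : 1 ≡ q ^ n [MOD q ^ n - 1] := (Nat.modEq_iff_dvd' (Nat.one_le_pow _ _ hq)).2 dvd_rfl
  have h2 := h.mul_right (q ^ (n - k))
  rw [mul_assoc, ← pow_add, Nat.add_sub_cancel' hk] at h2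
  have h3 := h1.mul_left s
  rw [mul_one] at h3
  exact h3.trans h2.symm

/-- Equality of cosets gives a congruence with a reduced exponent. -/
lemma exists_lt_modEq_of_coset_eq {q m s t : ℕ} (hq : 1 ≤ q) (hm : 0 < m)
    (h : coset q (q ^ (2 * m) - 1) s = coset q (q ^ (2 * m) - 1) t) :
    ∃ l < m, t ≡ s * q ^ (2 * l) [MOD q ^ (2 * m) - 1] := by
  have hmem : (t : ZMod (q ^ (2 * m) - 1)) ∈ coset q (q ^ (2 * m) - 1) s := by
    rw [h]
    exact ⟨0, by simp⟩
  obtain ⟨l, hl⟩ := hmem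
  refine ⟨l % m, Nat.mod_lt _ hm, ?_⟩
  have h1 : 1 ≡ q ^ (2 * m) [MOD q ^ (2 * m) - 1] :=
    (Nat.modEq_iff_dvd' (Nat.one_le_pow _ _ hq)).2 dvd_rfl
  have h2 : t ≡ s * q ^ (2 * l) [MOD q ^ (2 * m) - 1] := by
    rw [← ZMod.natCast_eq_natCast_iff]
    push_cast
    exact hl
  refine h2.trans (Nat.ModEq.mul_left _ ?_)
  conv_lhs => rw [← Nat.mod_add_div l m, mul_add, pow_add, ← mul_assoc, pow_mul q (2 * m)]
  simpa using ((h1.symm.pow (l / m)).mul_left (q ^ (2 * (l % m))))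

/-- If `t ≡ s * q ^ k` modulo `q ^ n - 1` without wrap-around, then equality holds. -/
lemma eq_mul_pow_of_modEq {q m s t k : ℕ} (hq : 2 ≤ q) (hs : s < q ^ (m + 1))
    (ht : t < q ^ (m + 1)) (hm : 2 ≤ m) (hk : k + 2 ≤ m)
    (h : t ≡ s * q ^ k [MOD q ^ (2 * m) - 1]) : t = s * q ^ k := by
  have hq0 : 0 < q := by lia
  have hlt : q ^ (2 * m - 1) ≤ q ^ (2 * m) - 1 :=
    Nat.le_sub_one_of_lt (Nat.pow_lt_pow_right hq (by lia))
  refine h.eq_of_lt_of_lt ?_ ?_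
  · exact (ht.trans_le (Nat.pow_le_pow_right hq0 (by lia))).trans_le hlt
  · calc s * q ^ k < q ^ (m + 1) * q ^ k := Nat.mul_lt_mul_of_pos_right hs (pow_pos hq0 k)
      _ = q ^ (m + 1 + k) := (pow_add ..).symm
      _ ≤ q ^ (2 * m - 1) := Nat.pow_le_pow_right hq0 (by lia)
      _ ≤ _ := hlt

/-- Multiplication by `Q` modulo `Q ^ 2 - 1` swaps the two base-`Q` digits. -/
lemma digits_swap_of_modEq {q Q s t : ℕ} (hqQ : q < Q) (hs : s < q * Q) (ht : t < q * Q)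
    (h : t ≡ s * Q [MOD Q ^ 2 - 1]) :
    ∃ x < q, ∃ y < q, s = x * Q + y ∧ t = y * Q + x := by
  have hQ : 0 < Q := by lia
  have hx : s / Q < q := Nat.div_lt_of_lt_mul (by rwa [mul_comm])
  have hy : s % Q < Q := Nat.mod_lt _ hQ
  have hsd := Nat.div_add_mod' s Q
  have h1 : 1 ≡ Q ^ 2 [MOD Q ^ 2 - 1] :=
    (Nat.modEq_iff_dvd' (Nat.one_le_pow _ _ hQ)).2 dvd_rfl
  have h2 : s * Q ≡ s % Q * Q + s / Q [MOD Q ^ 2 - 1] := by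
    have e : s * Q = s % Q * Q + s / Q * Q ^ 2 := by
      conv_lhs => rw [← hsd]
      ring
    rw [e]
    simpa using (h1.symm.mul_left (s / Q)).add_left (s % Q * Q)
  have ht' : t = s % Q * Q + s / Q := by
    refine (h.trans h2).eq_of_lt_of_lt ?_ ?_
    · refine Nat.lt_sub_of_add_lt ?_
      nlinarith
    · refine Nat.lt_sub_of_add_lt ?_
      nlinarith
  refine ⟨s / Q, hx, s % Q, ?_, hsd.symm, ht'⟩
  by_contra! hcon
  have := Nat.mul_le_mul_right Q hcon
  lia

/-- Elements `1 + (q + 1) * j` with `j` up to `δ^max - 2` are below `q ^ (m + 1)`. -/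
lemma one_add_mul_lt_of_le_deltaMax {q m j : ℕ} (hq : 2 ≤ q) (hm : 2 ≤ m) (hj : 0 < j)
    (h : j ≤ deltaMax q m - 2) : 1 + (q + 1) * j < q ^ (m + 1) := by
  have hle : q ^ 2 ≤ q ^ (m + 1) := Nat.pow_le_pow_right (by lia) (by lia)
  have hsq : 2 * q ≤ q ^ 2 := by nlinarith
  unfold deltaMax at h
  split_ifs at h with hc
  · obtain ⟨rfl, h5⟩ := hc
    have h1 : j + 1 ≤ (q ^ 3 - q ^ 2 + q + 3) / (q + 1) := by lia
    have h2 := (Nat.le_div_iff_mul_le (by lia)).1 h1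
    have h3 : 5 * q ≤ q ^ 2 := by nlinarith
    have h4 : (j + 1) * (q + 1) = (q + 1) * j + q + 1 := by ring
    norm_num at hle ⊢
    lia
  · have h1 : j + 2 ≤ (q ^ (m + 1) - q ^ 2 + q + 3) / (q + 1) := by lia
    have h2 := (Nat.le_div_iff_mul_le (by lia)).1 h1
    have h4 : (j + 2) * (q + 1) = (q + 1) * j + 2 * q + 2 := by ring
    lia

lemma modEq_sub_one_of_sq_dvd {q j : ℕ} (hq : 1 ≤ q) (h : q ^ 2 ∣ 1 + (q + 1) * j) :
    j ≡ q - 1 [MOD q ^ 2] := by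
  obtain ⟨c, hc⟩ := h
  rw [← Int.natCast_modEq_iff]
  refine Int.modEq_iff_dvd.2 ⟨(q - 1) * c - j, ?_⟩
  push_cast [Nat.cast_sub hq]
  have hc' : (1 + (q + 1) * j : ℤ) = q ^ 2 * c := by exact_mod_cast hc
  linear_combination ((q : ℤ) - 1) * hc'

theorem stmt15 (q m : ℕ) (hq : IsPrimePow q) (hm : 2 ≤ m) (hme : Even m)
    (r : ℕ) (hr : r = q + 1)
    (i ibar : ℕ) (hij : i < ibar) (hibar : ibar ≤ deltaMax q m - 2)
    (hc : coset q (q ^ (2 * m) - 1) (1 + r * i)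
        = coset q (q ^ (2 * m) - 1) (1 + r * ibar)) :
    ibar ≡ q - 1 [MOD q ^ 2] ∨
      ∃ w : ℕ, 2 ≤ w ∧ w ≤ q - 1 ∧ i = w * ((q ^ m - 1) / (q + 1)) + 1 ∧
        ibar = q ^ m - (w - 1) * ((q ^ m - 1) / (q + 1)) := by
  subst hr
  have hq2 : 2 ≤ q := hq.two_le
  have hq1 : 1 ≤ q := by lia
  have hb := one_add_mul_lt_of_le_deltaMax hq2 hm (by lia) hibar
  have hab : 1 + (q + 1) * i < 1 + (q + 1) * ibar := by gcongr
  have ha := hab.trans hb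
  obtain ⟨l, hlm, hl⟩ := exists_lt_modEq_of_coset_eq hq1 (by lia) hc
  obtain ⟨t, ht⟩ := hme
  rcases lt_trichotomy l t with hlt | rfl | hgt
  · have h := eq_mul_pow_of_modEq hq2 ha hb hm (by lia) hl
    rcases Nat.eq_zero_or_pos l with rfl | hl0
    · simp only [mul_zero, pow_zero, mul_one] at h
      lia
    · exact .inl (modEq_sub_one_of_sq_dvd hq1
        (h ▸ Dvd.dvd.mul_left (pow_dvd_pow q (by lia)) _))
  · have hqQ : q < q ^ m := by
      simpa using Nat.pow_lt_pow_right (a := q) (m := 1) (n := m) hq2 (by lia)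
    rw [show 2 * l = m by lia, mul_comm 2 m, pow_mul] at hl
    rw [pow_succ'] at ha hb
    obtain ⟨x, hx, y, hy, hax, hby⟩ := digits_swap_of_modEq hqQ ha hb hl
    have hdvd : q + 1 ∣ q ^ m - 1 := by
      have h1 : q ^ 2 - 1 ∣ (q ^ 2) ^ l - 1 := by simpa using Nat.sub_dvd_pow_sub_pow (q ^ 2) 1 l
      rw [← pow_mul, show 2 * l = m by lia] at h1
      refine Dvd.dvd.trans ⟨q - 1, ?_⟩ h1
      simpa using Nat.sq_sub_sq q 1
    obtain ⟨c, hcq⟩ := hdvd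
    have hQ : q ^ m = (q + 1) * c + 1 := by lia
    rw [hcq, Nat.mul_div_cancel_left c (Nat.succ_pos q)]
    have hxy : x < y := by
      by_contra! hyx
      have : (y : ℤ) * (q ^ m - 1) ≤ x * (q ^ m - 1) :=
        mul_le_mul_of_nonneg_right (by exact_mod_cast hyx)
          (by have : (1 : ℤ) ≤ q ^ m := by exact_mod_cast Nat.one_le_pow _ _ hq1
              lia)
      zify at hab hax hby
      nlinarith
    have hsum : x + y ≡ 1 [MOD q + 1] := by
      have h1 : 1 + (q + 1) * i = (q + 1) * (x * c) + (x + y) := by rw [hax, hQ]; ring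
      have h2 : (1 + (q + 1) * i) % (q + 1) = ((q + 1) * (x * c) + (x + y)) % (q + 1) := by rw [h1]
      rw [Nat.add_mul_mod_self_left, Nat.mul_add_mod] at h2
      exact h2.symm
    obtain ⟨d, hd⟩ := (Nat.modEq_iff_dvd' (by lia)).1 hsum.symm
    have hd2 : d < 2 := by
      by_contra! h
      have := Nat.mul_le_mul_left (q + 1) h
      lia
    interval_cases d
    · left
      obtain rfl : x = 0 := by lia
      obtain rfl : y = 1 := by lia
      refine modEq_sub_one_of_sq_dvd hq1 ?_
      rw [hby, one_mul, add_zero]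
      exact pow_dvd_pow q hm
    · right
      refine ⟨x, by lia, by lia, ?_, ?_⟩
      · refine Nat.eq_of_mul_eq_mul_left (Nat.succ_pos q) ?_
        rw [hQ] at hax
        have : y = q + 2 - x := by lia
        zify [show x ≤ q + 2 by lia] at *
        linear_combination hax + this
      · refine Nat.eq_sub_of_add_eq ?_
        refine Nat.eq_of_mul_eq_mul_left (Nat.succ_pos q) ?_
        rw [hQ] at hby ⊢
        have : y = q + 2 - x := by lia
        zify [show x ≤ q + 2 by lia, show 1 ≤ x by lia] at *
        rw [this] at hby
        linear_combination hby
  · have h := eq_mul_pow_of_modEq hq2 hb ha hm (by lia)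
      (mul_pow_modEq_of_pow_modEq hq1 (by lia) hl)
    have := Nat.le_mul_of_pos_right (1 + (q + 1) * ibar) (pow_pos hq1 (2 * m - 2 * l))
    lia
end

section
/- Let q be a prime power, m ≥ 2 an even integer, and r = q+1. For all integers i and ī, the congruence (1+r·i)·q^m ≡ 1+r·ī (mod q^{2m}−1) holds if and only if ī ≡ i + (1+r·i)·(q^m−1)/(q+1) (mod (q^{2m}−1)/(q+1)). -/
theorem cast_pow_sub_one_div_add_one_mul {q k : ℕ} (hq : 0 < q) (hk : Even k) :
    ((q : ℤ) + 1) * (((q ^ k - 1) / (q + 1) : ℕ) : ℤ) = (q : ℤ) ^ k - 1 := by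
  have hdvd : q + 1 ∣ q ^ k - 1 := by
    obtain ⟨n, rfl⟩ := hk.two_dvd
    have hsq : q + 1 ∣ q ^ 2 - 1 ^ 2 := by
      rw [Nat.sq_sub_sq]
      exact dvd_mul_right _ _
    rw [one_pow] at hsq
    rw [pow_mul]
    exact hsq.trans (Nat.sub_one_dvd_pow_sub_one _ n)
  have hmul : (q + 1) * ((q ^ k - 1) / (q + 1)) + 1 = q ^ k := by
    rw [Nat.mul_div_cancel' hdvd, Nat.sub_add_cancel (Nat.one_le_pow _ _ hq)]
  rw [eq_sub_iff_add_eq]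
  exact_mod_cast hmul

theorem stmt17 (q m : ℕ) (hq : IsPrimePow q) (hm : 2 ≤ m) (hme : Even m)
    (i ibar : ℤ) :
    (1 + ((q : ℤ) + 1) * i) * (q : ℤ) ^ m ≡ 1 + ((q : ℤ) + 1) * ibar
        [ZMOD ((q : ℤ) ^ (2 * m) - 1)] ↔
    ibar ≡ i + (1 + ((q : ℤ) + 1) * i) * (((q ^ m - 1) / (q + 1) : ℕ) : ℤ)
        [ZMOD (((q ^ (2 * m) - 1) / (q + 1) : ℕ) : ℤ)] := by
  have hm' := cast_pow_sub_one_div_add_one_mul hq.pos hme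
  rw [← cast_pow_sub_one_div_add_one_mul hq.pos (even_two_mul m), Int.modEq_iff_dvd,
    Int.modEq_comm, Int.modEq_iff_dvd]
  generalize (((q ^ m - 1) / (q + 1) : ℕ) : ℤ) = a at hm' ⊢
  have hfactor : 1 + ((q : ℤ) + 1) * ibar - (1 + ((q : ℤ) + 1) * i) * (q : ℤ) ^ m =
      ((q : ℤ) + 1) * (ibar - (i + (1 + ((q : ℤ) + 1) * i) * a)) := by
    linear_combination (1 + ((q : ℤ) + 1) * i) * hm'
  rw [hfactor, mul_dvd_mul_iff_left (by positivity)]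
end
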